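/- arXiv:2601.07164 — 5 statements merged into one kernel-verified Lean document; each statement's English description precedes it below -/
import Mathlib

section
/- Let T_π be the Bellman operator of a transition kernel p, reward function r and policy π with discount γ ∈ [0,1), and let Q^π be its fixed point. If a Q-function Q̂ and a constant c ≥ 0 satisfy (T_π Q̂)(s,a) ≥ Q̂(s,a) − c for all (s,a), then Q^π(s,a) ≥ Q̂(s,a) − c/(1−γ) for all (s,a). -/
/-- The Bellman operator `T_π` for kernel `p`, reward `r`, discount `γ` and
deterministic policy `π`. -/
def bellman {S A : Type*} [Fintype S] (γ : ℝ) (p : S → A → S → ℝ)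
    (r : S → A → ℝ) (π : S → A) (Q : S → A → ℝ) : S → A → ℝ :=
  fun s a => r s a + γ * ∑ s' : S, p s a s' * Q s' (π s')

/-- Bellman operators with a common reward differ by at most `γ * M` when the Q-functions
differ by at most `M`. -/
lemma bellman_sub_le {S A : Type*} [Fintype S] {γ : ℝ} (hγ0 : 0 ≤ γ) {p : S → A → S → ℝ}
    (hp0 : ∀ s a s', 0 ≤ p s a s') (hp1 : ∀ s a, ∑ s' : S, p s a s' = 1)
    (r : S → A → ℝ) (π : S → A) {Q Q' : S → A → ℝ} {M : ℝ}
    (hM : ∀ s a, Q s a - Q' s a ≤ M) (s : S) (a : A) :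
    bellman γ p r π Q s a - bellman γ p r π Q' s a ≤ γ * M := by
  have hsum : ∑ s' : S, p s a s' * (Q s' (π s') - Q' s' (π s')) ≤ M :=
    calc ∑ s' : S, p s a s' * (Q s' (π s') - Q' s' (π s'))
        ≤ ∑ s' : S, p s a s' * M :=
          Finset.sum_le_sum fun s' _ => mul_le_mul_of_nonneg_left (hM _ _) (hp0 s a s')
      _ = M := by rw [← Finset.sum_mul, hp1, one_mul]
  calc bellman γ p r π Q s a - bellman γ p r π Q' s a
      = γ * ∑ s' : S, p s a s' * (Q s' (π s') - Q' s' (π s')) := by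
        simp only [bellman, mul_sub, Finset.sum_sub_distrib]
        ring
    _ ≤ γ * M := mul_le_mul_of_nonneg_left hsum hγ0

/-- If `Q^π` is the fixed point of `T_π` and `(T_π Q̂)(s,a) ≥ Q̂(s,a) − c` for a
constant `c ≥ 0`, then `Q^π(s,a) ≥ Q̂(s,a) − c/(1−γ)` for all `(s,a)`. -/
theorem fixed_point_lower_bound {S A : Type*} [Fintype S] [Fintype A]
    [Nonempty S] [Nonempty A]
    (γ : ℝ) (hγ0 : 0 ≤ γ) (hγ1 : γ < 1)
    (p : S → A → S → ℝ)
    (hp0 : ∀ s a s', 0 ≤ p s a s')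
    (hp1 : ∀ s a, ∑ s' : S, p s a s' = 1)
    (r : S → A → ℝ) (π : S → A)
    (Qpi : S → A → ℝ)
    (hfix : ∀ s a, Qpi s a = bellman γ p r π Qpi s a)
    (Qhat : S → A → ℝ) (c : ℝ) (hc : 0 ≤ c)
    (hTQ : ∀ s a, bellman γ p r π Qhat s a ≥ Qhat s a - c) :
    ∀ s a, Qpi s a ≥ Qhat s a - c / (1 - γ) := by
  obtain ⟨⟨s₀, a₀⟩, hmax⟩ := Finite.exists_max fun x : S × A => Qhat x.1 x.2 - Qpi x.1 x.2
  have hM : ∀ s a, Qhat s a - Qpi s a ≤ Qhat s₀ a₀ - Qpi s₀ a₀ := fun s a => hmax (s, a)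
  have hstep := bellman_sub_le hγ0 hp0 hp1 r π hM s₀ a₀
  have hbound : Qhat s₀ a₀ - Qpi s₀ a₀ ≤ c / (1 - γ) := by
    rw [le_div_iff₀ (sub_pos.mpr hγ1)]
    linarith [hTQ s₀ a₀, hfix s₀ a₀]
  intro s a
  linarith [hM s a]
end

section
/- Fix a task l with reward r_l and kernel p_l, policies π_1, …, π_L, and for each j let Q_l^{π_j} be the fixed point of the Bellman operator of (p_l, r_l) with policy π_j. Suppose ε ≥ 0 and Q̂ is a Q-function with |Q_l^{π_l}(s,a) − Q̂(s,a)| ≤ ε for all (s,a); suppose Q_l^{π_j}(s,a) ≤ Q_l^{π_l}(s,a) for all j and all (s,a); and suppose the policy π is greedy with respect to Q̂, i.e., Q̂(s, π s) = max_{a ∈ A} Q̂(s,a) for every s. Then for every j and all (s,a): (T_{l,π} Q̂)(s,a) ≥ Q_l^{π_j}(s,a) − γ·ε, where T_{l,π} is the Bellman operator of (p_l, r_l) with policy π. -/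
open Finset

/-- One-step bound: if `Q̂` is `ε`-close to `Q_l^{π_l}`, each `Q_l^{π_j}` is
dominated by `Q_l^{π_l}`, and `π` is greedy w.r.t. `Q̂`, then
`(T_{l,π} Q̂)(s,a) ≥ Q_l^{π_j}(s,a) − γ·ε` for all `j` and `(s,a)`. -/
theorem greedy_one_step_bound {S A : Type*} [Fintype S] [Fintype A]
    [Nonempty S] [Nonempty A]
    (γ : ℝ) (hγ0 : 0 ≤ γ) (hγ1 : γ < 1)
    (L : ℕ) (rl : S → A → ℝ) (pl : S → A → S → ℝ)
    (hp0 : ∀ s a s', 0 ≤ pl s a s')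
    (hp1 : ∀ s a, ∑ s' : S, pl s a s' = 1)
    (πs : Fin L → S → A) (l : Fin L)
    (Q : Fin L → S → A → ℝ)
    (hfix : ∀ j, ∀ s a, Q j s a = bellman γ pl rl (πs j) (Q j) s a)
    (ε : ℝ) (hε : 0 ≤ ε)
    (Qhat : S → A → ℝ)
    (hclose : ∀ s a, |Q l s a - Qhat s a| ≤ ε)
    (hdom : ∀ j, ∀ s a, Q j s a ≤ Q l s a)
    (π : S → A)
    (hgreedy : ∀ s, Qhat s (π s) =
      Finset.univ.sup' Finset.univ_nonempty (fun a : A => Qhat s a)) :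
    ∀ j, ∀ s a, bellman γ pl rl π Qhat s a ≥ Q j s a - γ * ε := by
  intro j s a
  have hpt : ∀ s', Q j s' (πs j s') - ε ≤ Qhat s' (π s') := by
    intro s'
    have hmax : Qhat s' (πs j s') ≤ Qhat s' (π s') := by
      rw [hgreedy s']
      exact Finset.le_sup' (fun a : A => Qhat s' a) (Finset.mem_univ _)
    linarith [(abs_le.mp (hclose s' (πs j s'))).2, hdom j s' (πs j s')]
  have hsum : ∑ s', pl s a s' * Q j s' (πs j s') - ε ≤ ∑ s', pl s a s' * Qhat s' (π s') :=
    calc ∑ s', pl s a s' * Q j s' (πs j s') - ε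
        = ∑ s', pl s a s' * (Q j s' (πs j s') - ε) := by
          simp only [mul_sub, Finset.sum_sub_distrib, ← Finset.sum_mul, hp1, one_mul]
      _ ≤ ∑ s', pl s a s' * Qhat s' (π s') :=
          Finset.sum_le_sum fun s' _ => mul_le_mul_of_nonneg_left (hpt s') (hp0 s a s')
  have hγ := mul_le_mul_of_nonneg_left hsum hγ0
  rw [hfix j s a]
  simp only [bellman]
  linarith
end

section
/- (Generalized Policy Improvement.) Fix a task l with reward r_l and kernel p_l, policies π_1, …, π_L, and for each j let Q_l^{π_j} be the fixed point of the Bellman operator of (p_l, r_l) with policy π_j. Suppose ε ≥ 0 and Q̂ is a Q-function with |Q_l^{π_l}(s,a) − Q̂(s,a)| ≤ ε for all (s,a); suppose Q_l^{π_j}(s,a) ≤ Q_l^{π_l}(s,a) for all j and all (s,a); and suppose the policy π is greedy with respect to Q̂, i.e., Q̂(s, π s) = max_{a ∈ A} Q̂(s,a) for every s. Let Q_l^π be the fixed point of the Bellman operator of (p_l, r_l) with policy π. Then for all (s,a): Q_l^π(s,a) ≥ max_{1 ≤ j ≤ L} Q_l^{π_j}(s,a) − (2/(1−γ))·ε. 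-/
open Finset

/-- If one-step switching from `π₁` to `π₂` loses at most `δ` in the action values of `π₁`,
then the action values of `π₂` lose at most `γ δ / (1 - γ)`. -/
theorem bellman_fixed_sub_le {S A : Type*} [Fintype S] [Finite A]
    {γ : ℝ} (hγ0 : 0 ≤ γ) (hγ1 : γ < 1) {r : S → A → ℝ} {p : S → A → S → ℝ}
    (hp0 : ∀ s a s', 0 ≤ p s a s') (hp1 : ∀ s a, ∑ s' : S, p s a s' = 1)
    {π₁ π₂ : S → A} {Q₁ Q₂ : S → A → ℝ}
    (h₁ : ∀ s a, Q₁ s a = bellman γ p r π₁ Q₁ s a)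
    (h₂ : ∀ s a, Q₂ s a = bellman γ p r π₂ Q₂ s a)
    {δ : ℝ} (hδ : ∀ s, Q₁ s (π₁ s) ≤ Q₁ s (π₂ s) + δ) (s : S) (a : A) :
    Q₁ s a - Q₂ s a ≤ γ * δ / (1 - γ) := by
  have : Nonempty (S × A) := ⟨(s, a)⟩
  obtain ⟨⟨s₀, a₀⟩, hmax⟩ := Finite.exists_max fun x : S × A => Q₁ x.1 x.2 - Q₂ x.1 x.2
  set D := Q₁ s₀ a₀ - Q₂ s₀ a₀ with hD
  have hle : ∀ s a, Q₁ s a - Q₂ s a ≤ D := fun s a => hmax (s, a)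
  have hsum : ∑ s', p s₀ a₀ s' * Q₁ s' (π₁ s') - ∑ s', p s₀ a₀ s' * Q₂ s' (π₂ s') ≤ D + δ := by
    calc _ = ∑ s', p s₀ a₀ s' * (Q₁ s' (π₁ s') - Q₂ s' (π₂ s')) := by
          simp only [mul_sub, Finset.sum_sub_distrib]
      _ ≤ ∑ s', p s₀ a₀ s' * (D + δ) :=
          Finset.sum_le_sum fun s' _ => mul_le_mul_of_nonneg_left
            (by linarith [hδ s', hle s' (π₂ s')]) (hp0 _ _ _)
      _ = D + δ := by rw [← Finset.sum_mul, hp1, one_mul]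
  have hstep : D ≤ γ * (D + δ) := by
    have e₁ := h₁ s₀ a₀
    have e₂ := h₂ s₀ a₀
    simp only [bellman] at e₁ e₂
    have := mul_le_mul_of_nonneg_left hsum hγ0
    rw [mul_sub] at this
    linarith
  refine (hle s a).trans ?_
  rw [le_div_iff₀ (by linarith)]
  linarith

/-- Generalized Policy Improvement: if `Q̂` is `ε`-close to `Q_l^{π_l}`, each
`Q_l^{π_j}` is dominated by `Q_l^{π_l}`, and `π` is greedy w.r.t. `Q̂`, then the
action-value `Q_l^π` of `π` satisfies
`Q_l^π(s,a) ≥ max_j Q_l^{π_j}(s,a) − (2/(1−γ))·ε` for all `(s,a)`. -/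
theorem generalized_policy_improvement {S A : Type*} [Fintype S] [Fintype A]
    [Nonempty S] [Nonempty A]
    (γ : ℝ) (hγ0 : 0 ≤ γ) (hγ1 : γ < 1)
    (L : ℕ) [Nonempty (Fin L)]
    (rl : S → A → ℝ) (pl : S → A → S → ℝ)
    (hp0 : ∀ s a s', 0 ≤ pl s a s')
    (hp1 : ∀ s a, ∑ s' : S, pl s a s' = 1)
    (πs : Fin L → S → A) (l : Fin L)
    (Q : Fin L → S → A → ℝ)
    (hfix : ∀ j, ∀ s a, Q j s a = bellman γ pl rl (πs j) (Q j) s a)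
    (ε : ℝ) (hε : 0 ≤ ε)
    (Qhat : S → A → ℝ)
    (hclose : ∀ s a, |Q l s a - Qhat s a| ≤ ε)
    (hdom : ∀ j, ∀ s a, Q j s a ≤ Q l s a)
    (π : S → A)
    (hgreedy : ∀ s, Qhat s (π s) =
      Finset.univ.sup' Finset.univ_nonempty (fun a : A => Qhat s a))
    (Qpi : S → A → ℝ)
    (hfixπ : ∀ s a, Qpi s a = bellman γ pl rl π Qpi s a) :
    ∀ s a, Qpi s a ≥
      (Finset.univ.sup' Finset.univ_nonempty (fun j : Fin L => Q j s a))
        - (2 / (1 - γ)) * ε := by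
  intro s a
  have hδ : ∀ s, Q l s (πs l s) ≤ Q l s (π s) + 2 * ε := fun s => by
    have hmax : Qhat s (πs l s) ≤ Qhat s (π s) := by
      rw [hgreedy s]
      exact Finset.le_sup' (fun a => Qhat s a) (Finset.mem_univ _)
    linarith [(abs_le.mp (hclose s (πs l s))).2, (abs_le.mp (hclose s (π s))).1]
  have hloss := bellman_fixed_sub_le hγ0 hγ1 hp0 hp1 (hfix l) hfixπ hδ s a
  have hconst : γ * (2 * ε) / (1 - γ) ≤ 2 / (1 - γ) * ε := by
    rw [div_mul_eq_mul_div]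
    exact div_le_div_of_nonneg_right (by nlinarith) (by linarith)
  have hsup : Finset.univ.sup' Finset.univ_nonempty (fun j : Fin L => Q j s a) ≤ Q l s a :=
    Finset.sup'_le _ _ fun j _ => hdom j s a
  linarith
end

section
/- (Cross-task value gap with shared successor features.) Let r_i, r_j be reward functions and p_i, p_j transition kernels, and let Q_I, Q_J be Q-functions satisfying the Bellman optimality equations Q_I(s,a) = r_i s a + γ · ∑_{s'} p_i s a s' · max_{a'} Q_I(s',a') and Q_J(s,a) = r_j s a + γ · ∑_{s'} p_j s a s' · max_{a'} Q_J(s',a') for all (s,a). Suppose there exist ψ : S → A → ℝ^d with ‖ψ(s,a)‖ ≤ ψ_max for all (s,a) and vectors W_i, W_j ∈ ℝ^d such that Q_I(s,a) = ⟪ψ(s,a), W_i⟫ and Q_J(s,a) = ⟪ψ(s,a), W_j⟫ for all (s,a). Let δ_r = max_{(s,a)} |r_i s a − r_j s a|. Then for all (s,a): |Q_I(s,a) − Q_J(s,a)| ≤ δ_r + 2γ·ψ_max·‖W_i‖ + γ·ψ_max·‖W_i − W_j‖. -/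
open Finset
open scoped RealInnerProductSpace

theorem abs_sup'_sub_sup'_le {ι : Type*} {s : Finset ι} (hs : s.Nonempty) {f g : ι → ℝ} {c : ℝ}
    (h : ∀ i ∈ s, |f i - g i| ≤ c) : |s.sup' hs f - s.sup' hs g| ≤ c := by
  have key : ∀ f g : ι → ℝ, (∀ i ∈ s, |f i - g i| ≤ c) → s.sup' hs f ≤ s.sup' hs g + c := by
    intro f g h
    refine Finset.sup'_le _ _ fun i hi => ?_
    linarith [Finset.le_sup' g hi, (abs_le.mp (h i hi)).2]
  have h1 := key f g h
  have h2 := key g f fun i hi => by rw [abs_sub_comm]; exact h i hi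
  rw [abs_le]
  constructor <;> linarith

theorem abs_sup'_le {ι : Type*} {s : Finset ι} (hs : s.Nonempty) {f : ι → ℝ} {c : ℝ}
    (h : ∀ i ∈ s, |f i| ≤ c) : |s.sup' hs f| ≤ c := by
  simpa using abs_sup'_sub_sup'_le hs (f := f) (g := fun _ => 0) (by simpa using h)

theorem abs_sum_mul_le_of_sum_eq_one {ι : Type*} {s : Finset ι} {p v : ι → ℝ} {c : ℝ}
    (hp0 : ∀ i ∈ s, 0 ≤ p i) (hp1 : ∑ i ∈ s, p i = 1) (hv : ∀ i ∈ s, |v i| ≤ c) :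
    |∑ i ∈ s, p i * v i| ≤ c :=
  calc |∑ i ∈ s, p i * v i| ≤ ∑ i ∈ s, |p i * v i| := Finset.abs_sum_le_sum_abs _ _
    _ ≤ ∑ i ∈ s, p i * c := by
      refine Finset.sum_le_sum fun i hi => ?_
      rw [abs_mul, abs_of_nonneg (hp0 i hi)]
      exact mul_le_mul_of_nonneg_left (hv i hi) (hp0 i hi)
    _ = c := by rw [← Finset.sum_mul, hp1, one_mul]

/-- Cross-task value gap with shared successor features: if the optimal values
`Q_I` and `Q_J` of two tasks decompose as `Q_I = ⟪ψ(s,a), W_i⟫` and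
`Q_J = ⟪ψ(s,a), W_j⟫` with a shared feature map `ψ` bounded by `ψ_max`, then
`|Q_I(s,a) − Q_J(s,a)| ≤ δ_r + 2γ·ψ_max·‖W_i‖ + γ·ψ_max·‖W_i − W_j‖`. -/
theorem cross_task_gap_shared_features {S A : Type*} [Fintype S] [Fintype A]
    [Nonempty S] [Nonempty A]
    (γ : ℝ) (hγ0 : 0 ≤ γ) (hγ1 : γ < 1)
    (ri rj : S → A → ℝ)
    (pi pj : S → A → S → ℝ)
    (hpi0 : ∀ s a s', 0 ≤ pi s a s') (hpi1 : ∀ s a, ∑ s' : S, pi s a s' = 1)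
    (hpj0 : ∀ s a s', 0 ≤ pj s a s') (hpj1 : ∀ s a, ∑ s' : S, pj s a s' = 1)
    (QI QJ : S → A → ℝ)
    (hQI : ∀ s a, QI s a = ri s a + γ * ∑ s' : S, pi s a s' *
      (Finset.univ.sup' Finset.univ_nonempty (fun a' : A => QI s' a')))
    (hQJ : ∀ s a, QJ s a = rj s a + γ * ∑ s' : S, pj s a s' *
      (Finset.univ.sup' Finset.univ_nonempty (fun a' : A => QJ s' a')))
    (d : ℕ) (ψ : S → A → EuclideanSpace ℝ (Fin d)) (ψmax : ℝ)
    (hψ : ∀ s a, ‖ψ s a‖ ≤ ψmax)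
    (Wi Wj : EuclideanSpace ℝ (Fin d))
    (hWi : ∀ s a, QI s a = ⟪ψ s a, Wi⟫)
    (hWj : ∀ s a, QJ s a = ⟪ψ s a, Wj⟫)
    (δr : ℝ)
    (hδr : δr = Finset.univ.sup' Finset.univ_nonempty
      (fun sa : S × A => |ri sa.1 sa.2 - rj sa.1 sa.2|)) :
    ∀ s a, |QI s a - QJ s a| ≤
      δr + 2 * γ * ψmax * ‖Wi‖ + γ * ψmax * ‖Wi - Wj‖ := by
  intro s a
  have inner_bound : ∀ s a (W : EuclideanSpace ℝ (Fin d)), |⟪ψ s a, W⟫| ≤ ψmax * ‖W‖ :=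
    fun s a W => (abs_real_inner_le_norm _ _).trans
      (mul_le_mul_of_nonneg_right (hψ s a) (norm_nonneg W))
  have hr : |ri s a - rj s a| ≤ δr := by
    rw [hδr]
    exact Finset.le_sup' (fun sa : S × A => |ri sa.1 sa.2 - rj sa.1 sa.2|)
      (Finset.mem_univ (s, a))
  rw [hQI s a, hQJ s a]
  set VI : S → ℝ := fun s' => Finset.univ.sup' Finset.univ_nonempty (fun a' : A => QI s' a')
  set VJ : S → ℝ := fun s' => Finset.univ.sup' Finset.univ_nonempty (fun a' : A => QJ s' a')
  have hVI : ∀ s', |VI s'| ≤ ψmax * ‖Wi‖ := fun s' =>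
    abs_sup'_le _ fun a' _ => by rw [hWi]; exact inner_bound _ _ _
  have hV : ∀ s', |VI s' - VJ s'| ≤ ψmax * ‖Wi - Wj‖ := fun s' =>
    abs_sup'_sub_sup'_le _ fun a' _ => by
      rw [hWi, hWj, ← inner_sub_right]; exact inner_bound _ _ _
  have h1 := abs_sum_mul_le_of_sum_eq_one (fun s' _ => hpi0 s a s') (hpi1 s a)
    (fun s' _ => hVI s')
  have h2 := abs_sum_mul_le_of_sum_eq_one (fun s' _ => hpj0 s a s') (hpj1 s a)
    (fun s' _ => hVI s')
  have h3 := abs_sum_mul_le_of_sum_eq_one (fun s' _ => hpj0 s a s') (hpj1 s a)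
    (fun s' _ => hV s')
  simp only [mul_sub, Finset.sum_sub_distrib] at h3
  have hsum : |∑ s', pi s a s' * VI s' - ∑ s', pj s a s' * VJ s'| ≤
      2 * (ψmax * ‖Wi‖) + ψmax * ‖Wi - Wj‖ := by
    rw [abs_le] at *
    constructor <;> linarith
  calc |ri s a + γ * ∑ s', pi s a s' * VI s' - (rj s a + γ * ∑ s', pj s a s' * VJ s')|
      = |(ri s a - rj s a) + γ * (∑ s', pi s a s' * VI s' - ∑ s', pj s a s' * VJ s')| := by
        congr 1; ring
    _ ≤ |ri s a - rj s a| + γ * |∑ s', pi s a s' * VI s' - ∑ s', pj s a s' * VJ s'| := by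
        refine (abs_add_le _ _).trans_eq ?_
        rw [abs_mul, abs_of_nonneg hγ0]
    _ ≤ δr + γ * (2 * (ψmax * ‖Wi‖) + ψmax * ‖Wi - Wj‖) :=
        add_le_add hr (mul_le_mul_of_nonneg_left hsum hγ0)
    _ = δr + 2 * γ * ψmax * ‖Wi‖ + γ * ψmax * ‖Wi - Wj‖ := by ring
end

section
/- (Jacobian determinant of a planar flow.) Let d ∈ ℕ, let u, w ∈ ℝ^d, let b ∈ ℝ, and let l : ℝ → ℝ be differentiable. Define f : ℝ^d → ℝ^d by f(z) = z + l(⟪w, z⟫ + b) • u. Then f is differentiable at every z ∈ ℝ^d, and the determinant of its derivative at z (as a linear map from ℝ^d to ℝ^d) equals 1 + l'(⟪w, z⟫ + b) · ⟪u, w⟫. -/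
open scoped RealInnerProductSpace

/-- The Fréchet derivative of a planar flow is a rank-one perturbation of the identity. -/
theorem hasFDerivAt_add_smul_inner {E : Type*} [NormedAddCommGroup E] [InnerProductSpace ℝ E]
    (u w : E) (b : ℝ) {l : ℝ → ℝ} {l' : ℝ} {z : E} (hl : HasDerivAt l l' (⟪w, z⟫ + b)) :
    HasFDerivAt (fun z : E => z + l (⟪w, z⟫ + b) • u)
      (ContinuousLinearMap.id ℝ E + (l' • innerSL ℝ w).smulRight u) z :=
  (hasFDerivAt_id z).add
    ((hl.comp_hasFDerivAt z ((innerSL ℝ w).hasFDerivAt.add_const b)).smul_const u)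

/-- Jacobian determinant of a planar flow: for `f(z) = z + l(⟪w, z⟫ + b) • u`
with `l` differentiable, `f` is differentiable everywhere and the determinant
of its derivative at `z` equals `1 + l'(⟪w, z⟫ + b) · ⟪u, w⟫`. -/
theorem planar_flow_jacobian_det
    (d : ℕ) (u w : EuclideanSpace ℝ (Fin d)) (b : ℝ)
    (l : ℝ → ℝ) (hl : Differentiable ℝ l)
    (f : EuclideanSpace ℝ (Fin d) → EuclideanSpace ℝ (Fin d))
    (hf : ∀ z, f z = z + l (⟪w, z⟫ + b) • u) :
    (∀ z, DifferentiableAt ℝ f z) ∧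
    (∀ z, LinearMap.det ((fderiv ℝ f z).toLinearMap)
        = 1 + deriv l (⟪w, z⟫ + b) * ⟪u, w⟫) := by
  have hderiv (z : EuclideanSpace ℝ (Fin d)) :=
    hasFDerivAt_add_smul_inner u w b (hl (⟪w, z⟫ + b)).hasDerivAt
  rw [← funext hf] at hderiv
  refine ⟨fun z => (hderiv z).differentiableAt, fun z => ?_⟩
  rw [(hderiv z).fderiv, real_inner_comm w u]
  exact LinearMap.transvection.det (deriv l (⟪w, z⟫ + b) • innerSL ℝ w).toLinearMap u
end
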